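/- Let Σ be a finite alphabet, φ : Σ* → Σ* a nonerasing morphism, and a ∈ Σ a letter of order 2 (i.e. |φ^n(a)| = Θ(n)) such that φ(a) = aγ for some nonempty γ ∈ Σ*. Then the pure morphic sequence α = φ^∞(a) is eventually periodic, and consequently, for every coding ψ, the subword complexity of β = ψ(α) satisfies p_β(n) = O(1). -/

import Mathlib

open Asymptotics Filter

/-- Apply a morphism (given by its values on letters) to a finite word. -/
def substWord {A : Type*} (φ : A → List A) : List A → List A
  | [] => []
  | a :: w => φ a ++ substWord φ w

/-- The `n`-th iterate of a morphism applied to a word. -/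
def iterWord {A : Type*} (φ : A → List A) (n : ℕ) (w : List A) : List A :=
  (substWord φ)^[n] w

/-- The letter `b` has finite order `k`: `k ≥ 1` and `|φ^n(b)| = Θ(n^(k−1))`. -/
def HasOrder {A : Type*} (φ : A → List A) (b : A) (k : ℕ) : Prop :=
  1 ≤ k ∧
    (fun n => ((iterWord φ n [b]).length : ℝ)) =Θ[atTop] (fun n => (n : ℝ) ^ (k - 1))

/-- The subword complexity of an infinite word `β`: the number of distinct
factors of `β` of length `n`. -/
noncomputable def complexity {B : Type*} (β : ℕ → B) (n : ℕ) : ℕ :=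
  Set.ncard {w : List B | ∃ i : ℕ, w = List.ofFn (fun j : Fin n => β (i + (j : ℕ)))}

theorem substWord_append {A : Type*} (φ : A → List A) (u v : List A) :
    substWord φ (u ++ v) = substWord φ u ++ substWord φ v := by
  induction u with
  | nil => rfl
  | cons b u ih => simp [substWord, ih]

theorem iterWord_succ {A : Type*} (φ : A → List A) (n : ℕ) (w : List A) :
    iterWord φ (n + 1) w = iterWord φ n (substWord φ w) :=
  Function.iterate_succ_apply _ _ _

theorem iterWord_succ' {A : Type*} (φ : A → List A) (n : ℕ) (w : List A) :
    iterWord φ (n + 1) w = substWord φ (iterWord φ n w) :=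
  Function.iterate_succ_apply' _ _ _

theorem iterWord_append {A : Type*} (φ : A → List A) (n : ℕ) (u v : List A) :
    iterWord φ n (u ++ v) = iterWord φ n u ++ iterWord φ n v := by
  induction n with
  | zero => rfl
  | succ n ih => simp only [iterWord_succ', ih, substWord_append]

theorem length_le_length_substWord {A : Type*} {φ : A → List A} (hφ : ∀ b, φ b ≠ [])
    (w : List A) : w.length ≤ (substWord φ w).length := by
  induction w with
  | nil => simp
  | cons b w ih =>
    have := List.length_pos_iff.2 (hφ b)
    simp only [substWord, List.length_append, List.length_cons]
    omega

theorem monotone_length_iterWord {A : Type*} {φ : A → List A} (hφ : ∀ b, φ b ≠ [])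
    (w : List A) : Monotone fun n => (iterWord φ n w).length :=
  monotone_nat_of_le_succ fun n => by
    rw [iterWord_succ']
    exact length_le_length_substWord hφ _

theorem iterWord_succ_singleton {A : Type*} {φ : A → List A} {a : A} {γ : List A}
    (ha : φ a = a :: γ) (n : ℕ) :
    iterWord φ (n + 1) [a] = iterWord φ n [a] ++ iterWord φ n γ := by
  rw [iterWord_succ, ← iterWord_append]
  simp [substWord, ha]

theorem length_iterWord_add_ge {A : Type*} {φ : A → List A} (hφ : ∀ b, φ b ≠ []) {a : A}
    {γ : List A} (ha : φ a = a :: γ) (n k : ℕ) :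
    k * (iterWord φ n γ).length ≤ (iterWord φ (n + k) [a]).length := by
  induction k with
  | zero => simp
  | succ k ih =>
    have hmono : (iterWord φ n γ).length ≤ (iterWord φ (n + k) γ).length :=
      monotone_length_iterWord hφ γ (Nat.le_add_right n k)
    rw [← add_assoc, iterWord_succ_singleton ha, List.length_append, add_mul, one_mul]
    exact add_le_add ih hmono

/-- If `φ(a) = aγ` and `a` has order 2, then the lengths of the words `φ^n(γ)` are bounded. -/
theorem HasOrder.eventually_length_iterWord_le {A : Type*} {φ : A → List A}
    (hφ : ∀ b, φ b ≠ []) {a : A} (ha2 : HasOrder φ a 2) {γ : List A} (ha : φ a = a :: γ) :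
    ∃ K : ℕ, ∀ᶠ n in atTop, (iterWord φ n γ).length ≤ K := by
  obtain ⟨C, hC⟩ := ha2.2.1.bound
  have h2 : Tendsto (fun n : ℕ => n + n) atTop atTop :=
    tendsto_atTop_mono (fun n => Nat.le_add_right n n) tendsto_id
  refine ⟨⌈C * 2⌉₊, ?_⟩
  filter_upwards [h2.eventually hC, eventually_gt_atTop 0] with n hn hpos
  have hpos' : (0 : ℝ) < n := by exact_mod_cast hpos
  have hlen : (n : ℝ) * (iterWord φ n γ).length ≤ (iterWord φ (n + n) [a]).length := by
    exact_mod_cast length_iterWord_add_ge hφ ha n n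
  have hbound : ((iterWord φ (n + n) [a]).length : ℝ) ≤ C * (n + n) := by
    simpa [abs_of_nonneg (add_nonneg hpos'.le hpos'.le)] using hn
  have : ((iterWord φ n γ).length : ℝ) ≤ C * 2 :=
    le_of_mul_le_mul_left (by linarith) hpos'
  exact_mod_cast this.trans (Nat.le_ceil _)

theorem exists_lt_iterWord_eq {A : Type*} [Finite A] {φ : A → List A} {γ : List A} {K : ℕ}
    (hK : ∀ᶠ n in atTop, (iterWord φ n γ).length ≤ K) :
    ∃ i j : ℕ, i < j ∧ iterWord φ i γ = iterWord φ j γ := by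
  obtain ⟨M, hM⟩ := eventually_atTop.1 hK
  obtain ⟨i, -, j, -, hij, heq⟩ := (Set.Ici_infinite M).exists_lt_map_eq_of_mapsTo
    (f := fun n => iterWord φ n γ) (t := {w : List A | w.length ≤ K})
    (fun n hn => hM n hn) (List.finite_length_le A K)
  exact ⟨i, j, hij, heq⟩

theorem iterWord_add_eq {A : Type*} {φ : A → List A} {γ : List A} {i j : ℕ}
    (h : iterWord φ i γ = iterWord φ j γ) (k : ℕ) :
    iterWord φ (i + k) γ = iterWord φ (j + k) γ := by
  induction k with
  | zero => exact h
  | succ k ih => rw [← add_assoc, ← add_assoc, iterWord_succ', iterWord_succ', ih]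

/-- Equality of `φ^i(γ)` and `φ^j(γ)` makes `φ^(i+k)(a)` and `φ^(j+k)(a)` extend `φ^i(a)` and
`φ^j(a)` by the same word. -/
theorem exists_common_extension {A : Type*} {φ : A → List A} (hφ : ∀ b, φ b ≠ []) {a : A}
    {γ : List A} (hγ : γ ≠ []) (ha : φ a = a :: γ) {i j : ℕ}
    (h : iterWord φ i γ = iterWord φ j γ) (k : ℕ) :
    ∃ u : List A, k ≤ u.length ∧ iterWord φ (i + k) [a] = iterWord φ i [a] ++ u ∧
      iterWord φ (j + k) [a] = iterWord φ j [a] ++ u := by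
  induction k with
  | zero => exact ⟨[], by simp⟩
  | succ k ih =>
    obtain ⟨u, hu, hi, hj⟩ := ih
    refine ⟨u ++ iterWord φ (i + k) γ, ?_, ?_, ?_⟩
    · have hlen : γ.length ≤ (iterWord φ (i + k) γ).length :=
        monotone_length_iterWord hφ γ (Nat.zero_le (i + k))
      have := List.length_pos_iff.2 hγ
      rw [List.length_append]
      omega
    · rw [← add_assoc, iterWord_succ_singleton ha, hi, List.append_assoc]
    · rw [← add_assoc, iterWord_succ_singleton ha, hj, ← iterWord_add_eq h, List.append_assoc]

theorem strictMono_length_iterWord {A : Type*} {φ : A → List A} (hφ : ∀ b, φ b ≠ []) {a : A}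
    {γ : List A} (hγ : γ ≠ []) (ha : φ a = a :: γ) :
    StrictMono fun n => (iterWord φ n [a]).length :=
  strictMono_nat_of_lt_succ fun n => by
    have hlen : γ.length ≤ (iterWord φ n γ).length :=
      monotone_length_iterWord hφ γ (Nat.zero_le n)
    have := List.length_pos_iff.2 hγ
    rw [iterWord_succ_singleton ha, List.length_append]
    omega

/-- An eventually periodic word with preperiod `N` and period `d` has at most `N + d` factors of
each length. -/
theorem complexity_le_of_eventually_periodic {B : Type*} {β : ℕ → B} {N d : ℕ} (hd : 1 ≤ d)
    (hβ : ∀ n, N ≤ n → β (n + d) = β n) (n : ℕ) : complexity β n ≤ N + d := by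
  have hshift : ∀ i, ∃ i' < N + d, ∀ j, β (i + j) = β (i' + j) := by
    intro i
    induction i using Nat.strong_induction_on with
    | _ i ih =>
      by_cases hi : i < N + d
      · exact ⟨i, hi, fun _ => rfl⟩
      · obtain ⟨i', hi', hj⟩ := ih (i - d) (by omega)
        refine ⟨i', hi', fun j => ?_⟩
        rw [← hj, ← hβ (i - d + j) (by omega)]
        congr 1
        omega
  have hsub : {w : List B | ∃ i : ℕ, w = List.ofFn (fun j : Fin n => β (i + (j : ℕ)))} ⊆
      (fun i => List.ofFn (fun j : Fin n => β (i + (j : ℕ)))) '' Set.Iio (N + d) := by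
    rintro w ⟨i, rfl⟩
    obtain ⟨i', hi', hj⟩ := hshift i
    exact ⟨i', hi', by simp only [hj]⟩
  calc complexity β n
      ≤ _ := Set.ncard_le_ncard hsub ((Set.finite_Iio _).image _)
    _ ≤ (Set.Iio (N + d)).ncard := Set.ncard_image_le (Set.finite_Iio _)
    _ = N + d := by simp [Set.ncard_eq_toFinset_card']

/-- If `a` is a letter of order 2 with `φ(a) = aγ` (`γ` nonempty), then the
pure morphic sequence `α = φ^∞(a)` is eventually periodic, and for every
coding `ψ` the subword complexity of `ψ(α)` is `O(1)`. -/
theorem stmt15 {A B : Type*} [Fintype A] [Fintype B]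
    (φ : A → List A) (hφ : ∀ b : A, φ b ≠ [])
    (a : A) (ha2 : HasOrder φ a 2)
    (γ : List A) (hγ : γ ≠ []) (ha : φ a = a :: γ)
    (α : ℕ → A)
    (hα : ∀ (n i : ℕ) (h : i < (iterWord φ n [a]).length),
      (iterWord φ n [a]).get ⟨i, h⟩ = α i) :
    (∃ N d : ℕ, 1 ≤ d ∧ ∀ n : ℕ, N ≤ n → α (n + d) = α n) ∧
    ∀ ψ : A → B,
      (fun n => (complexity (fun i => ψ (α i)) n : ℝ)) =O[atTop]
        (fun _ => (1 : ℝ)) := by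
  have hper : ∃ N d : ℕ, 1 ≤ d ∧ ∀ n : ℕ, N ≤ n → α (n + d) = α n := by
    obtain ⟨K, hK⟩ := ha2.eventually_length_iterWord_le hφ ha
    obtain ⟨i, j, hij, heq⟩ := exists_lt_iterWord_eq hK
    have hlt : (iterWord φ i [a]).length < (iterWord φ j [a]).length :=
      strictMono_length_iterWord hφ hγ ha hij
    refine ⟨(iterWord φ i [a]).length,
      (iterWord φ j [a]).length - (iterWord φ i [a]).length, by omega, fun n hn => ?_⟩
    obtain ⟨t, rfl⟩ := Nat.exists_eq_add_of_le hn
    obtain ⟨u, hu, hi, hj⟩ := exists_common_extension hφ hγ ha heq (t + 1)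
    have htu : t < u.length := hu
    have hread : ∀ m, iterWord φ (m + (t + 1)) [a] = iterWord φ m [a] ++ u →
        α ((iterWord φ m [a]).length + t) = u[t] := by
      intro m hm
      rw [← hα (m + (t + 1)) _ (by rw [hm, List.length_append]; omega)]
      simp [hm]
    rw [hread i hi, ← hread j hj]
    congr 1
    omega
  refine ⟨hper, fun ψ => ?_⟩
  obtain ⟨N, d, hd, hα'⟩ := hper
  refine IsBigO.of_bound ((N + d : ℕ) : ℝ) (Eventually.of_forall fun n => ?_)
  have := complexity_le_of_eventually_periodic (β := fun i => ψ (α i)) hd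
    (fun n hn => congrArg ψ (hα' n hn)) n
  simpa using (Nat.cast_le (α := ℝ)).2 this
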